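/- (Power margin achieving a target outage probability, equation (24).) Let 0 < P₀ ≤ 1/2 be a target outage probability and set the power margin m = exp(√(−2σ²·ln(2P₀)) + σ²/2). Then the outage probability does not exceed the target: ∫₀^{I₀/m} p(I) dI ≤ P₀. -/

import Mathlib

open MeasureTheory Real

/-- A Gaussian tail bound on a half-line starting at a nonnegative point. -/
theorem integral_Ici_gaussian_le {b s : ℝ} (hb : 0 < b) (hs : 0 ≤ s) :
    ∫ t in Set.Ici s, exp (-b * t ^ 2) ≤ exp (-b * s ^ 2) * (√(π / b) / 2) := by
  have hint := integrable_exp_neg_mul_sq hb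
  have hshift : ∫ t in Set.Ioi s, exp (-b * t ^ 2) =
      ∫ u in Set.Ioi (0 : ℝ), exp (-b * (u + s) ^ 2) := by
    have hpre := (measurePreserving_add_right volume s).setIntegral_preimage_emb
      (measurableEmbedding_addRight s) (fun t => exp (-b * t ^ 2)) (Set.Ioi s)
    rw [← hpre]
    simp
  rw [integral_Ici_eq_integral_Ioi, hshift, ← integral_gaussian_Ioi, ← integral_const_mul]
  refine setIntegral_mono_on (hint.comp_add_right s).integrableOn
    (hint.const_mul _).integrableOn measurableSet_Ioi fun u hu => ?_
  rw [← exp_add]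
  have hu' : 0 < u := hu
  have hsu : 0 ≤ b * (u * s) := by positivity
  exact exp_le_exp.mpr (by linarith [show b * (u + s) ^ 2
    = b * s ^ 2 + b * u ^ 2 + 2 * (b * (u * s)) by ring])

/-- The substitution `I = I₀ * exp (-t - c)` maps `[s, ∞)` onto `(0, I₀ / exp (s + c)]`. -/
theorem image_mul_exp_neg_sub_Ici {I₀ : ℝ} (hI₀ : 0 < I₀) (s c : ℝ) :
    (fun t => I₀ * exp (-t - c)) '' Set.Ici s = Set.Ioc 0 (I₀ / exp (s + c)) := by
  have hdiv : I₀ / exp (s + c) = I₀ * exp (-s - c) := by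
    rw [div_eq_mul_inv, ← exp_neg]
    ring_nf
  rw [hdiv]
  ext x
  constructor
  · rintro ⟨t, ht, rfl⟩
    have ht' : s ≤ t := ht
    exact ⟨by positivity, mul_le_mul_of_nonneg_left (exp_le_exp.mpr (by linarith)) hI₀.le⟩
  · rintro ⟨hx, hxs⟩
    have hx' : exp (- (-log (x / I₀) - c) - c) = x / I₀ := by
      rw [← exp_log (div_pos hx hI₀)]
      simp
    refine ⟨-log (x / I₀) - c, ?_, ?_⟩
    · have hle : log (x / I₀) ≤ -s - c := by
        rw [log_le_iff_le_exp (div_pos hx hI₀), div_le_iff₀' hI₀]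
        exact hxs
      exact Set.mem_Ici.mpr (by linarith)
    · simp only [hx']
      field_simp

/-- The lognormal outage integral as a Gaussian tail integral. -/
theorem integral_lognormal_eq_integral_Ici_gaussian {σ I₀ : ℝ} (hI₀ : 0 < I₀) (s : ℝ) :
    ∫ I in Set.Ioc (0 : ℝ) (I₀ / exp (s + σ ^ 2 / 2)),
      (1 / (I * √(2 * π * σ ^ 2))) * exp (-(log (I / I₀) + σ ^ 2 / 2) ^ 2 / (2 * σ ^ 2)) =
    (√(2 * π * σ ^ 2))⁻¹ * ∫ t in Set.Ici s, exp (-(1 / (2 * σ ^ 2)) * t ^ 2) := by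
  have hderiv : ∀ t ∈ Set.Ici s, HasDerivWithinAt (fun t => I₀ * exp (-t - σ ^ 2 / 2))
      (-(I₀ * exp (-t - σ ^ 2 / 2))) (Set.Ici s) t := fun t _ => by
    have h : HasDerivAt (fun t => I₀ * exp (-t - σ ^ 2 / 2))
        (I₀ * (exp (-t - σ ^ 2 / 2) * -1)) t :=
      (((hasDerivAt_id t).neg.sub_const (σ ^ 2 / 2)).exp).const_mul I₀
    rw [mul_neg_one, mul_neg] at h
    exact h.hasDerivWithinAt
  have hinj : Set.InjOn (fun t => I₀ * exp (-t - σ ^ 2 / 2)) (Set.Ici s) := fun x _ y _ h => by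
    have := exp_injective (mul_left_cancel₀ hI₀.ne' h)
    linarith
  rw [← image_mul_exp_neg_sub_Ici hI₀, integral_image_eq_integral_abs_deriv_smul
    measurableSet_Ici hderiv hinj, ← integral_const_mul]
  refine setIntegral_congr_fun measurableSet_Ici fun t _ => ?_
  have hlog : log (I₀ * exp (-t - σ ^ 2 / 2) / I₀) + σ ^ 2 / 2 = -t := by
    rw [mul_div_cancel_left₀ _ hI₀.ne', log_exp]
    ring
  have hpos : 0 < I₀ * exp (-t - σ ^ 2 / 2) := by positivity
  simp only [hlog, smul_eq_mul, abs_neg, abs_of_pos hpos]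
  rw [one_div, mul_inv, ← mul_assoc, mul_inv_cancel_left₀ hpos.ne']
  congr 2
  ring

/-- Power margin achieving a target outage probability (equation (24)): for a target
outage probability `0 < P₀ ≤ 1/2`, the power margin `m = exp(√(−2σ²·ln(2P₀)) + σ²/2)`
guarantees `∫₀^{I₀/m} p(I) dI ≤ P₀`. -/
theorem outage_probability_le_target (σ I₀ : ℝ) (hσ : 0 < σ) (hI₀ : 0 < I₀)
    (P₀ : ℝ) (hP₀ : 0 < P₀) (hP₀' : P₀ ≤ 1 / 2)
    (m : ℝ) (hm : m = Real.exp (Real.sqrt (-(2 * σ ^ 2 * Real.log (2 * P₀))) + σ ^ 2 / 2)) :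
    ∫ I in Set.Ioc (0 : ℝ) (I₀ / m),
      (1 / (I * Real.sqrt (2 * Real.pi * σ ^ 2))) *
        Real.exp (-(Real.log (I / I₀) + σ ^ 2 / 2) ^ 2 / (2 * σ ^ 2)) ≤ P₀ := by
  subst hm
  set s := √(-(2 * σ ^ 2 * log (2 * P₀)))
  have hlog : log (2 * P₀) ≤ 0 := log_nonpos (by linarith) (by linarith)
  have hs2 : s ^ 2 = -(2 * σ ^ 2 * log (2 * P₀)) :=
    sq_sqrt (by nlinarith [mul_nonneg (sq_nonneg σ) (neg_nonneg.mpr hlog)])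
  have hexp : exp (-(1 / (2 * σ ^ 2)) * s ^ 2) = 2 * P₀ := by
    have hcancel : -(1 / (2 * σ ^ 2)) * s ^ 2 = log (2 * P₀) := by
      rw [hs2]
      field_simp
    rw [hcancel, exp_log (by positivity)]
  have htail := integral_Ici_gaussian_le (b := 1 / (2 * σ ^ 2)) (by positivity)
    (sqrt_nonneg _ : 0 ≤ s)
  rw [hexp, show π / (1 / (2 * σ ^ 2)) = 2 * π * σ ^ 2 by field_simp] at htail
  have hroot : 0 < √(2 * π * σ ^ 2) := sqrt_pos.mpr (by positivity)
  rw [integral_lognormal_eq_integral_Ici_gaussian hI₀, inv_mul_le_iff₀ hroot]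
  linarith
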